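/- arXiv:2501.07037 — 3 statements merged into one kernel-verified Lean document; each statement's English description precedes it below -/
import Mathlib

section
/- Let p be a prime, k ≥ 1, and q = p^k. Every integer group determinant of the general affine group GA(1,q) is of the form D = A·B^(q−1), where A is a ℤ_(q−1) integer group determinant and B is an integer with B ≡ A (mod q). -/
/-- The group determinant of a family of integers indexed by a finite group `G`:
`det (a (g * h⁻¹))`. -/
noncomputable def groupDet (G : Type*) [Group G] [Finite G] (a : G → ℤ) : ℤ :=
  letI : Fintype G := Fintype.ofFinite G
  letI : DecidableEq G := Classical.decEq G
  Matrix.det (Matrix.of fun g h : G => a (g * h⁻¹))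

/-- `D` is an integer group determinant of the finite group `G`. -/
def IsIntGroupDet (G : Type*) [Group G] [Finite G] (D : ℤ) : Prop :=
  ∃ a : G → ℤ, groupDet G a = D

/-- `D` is a `ℤ_m` integer group determinant: a determinant of an integer circulant
matrix `(a_{(i-j) mod m})`. -/
def IsCirculantDet (m : ℕ) (D : ℤ) : Prop :=
  ∃ a : Fin m → ℤ, (Matrix.circulant a).det = D

/-- The action of `F_q^×` on the additive group of `F_q` by multiplication, as a
homomorphism to the automorphism group of `Multiplicative F_q`. -/
noncomputable def GAaction (p k : ℕ) [Fact p.Prime] :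
    (GaloisField p k)ˣ →* MulAut (Multiplicative (GaloisField p k)) where
  toFun u :=
    { toFun := fun x => Multiplicative.ofAdd (u • x.toAdd)
      invFun := fun x => Multiplicative.ofAdd (u⁻¹ • x.toAdd)
      left_inv := fun x => by simp
      right_inv := fun x => by simp
      map_mul' := fun x y => by
        simp [toAdd_mul, smul_add, ofAdd_add] }
  map_one' := by
    ext x
    simp
  map_mul' u v := by
    ext x
    simp [mul_smul]

instance {N G : Type*} [Group N] [Group G] {φ : G →* MulAut N} [Finite N] [Finite G] :
    Finite (N ⋊[φ] G) :=
  Finite.of_equiv (N × G)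
    ⟨fun x => ⟨x.1, x.2⟩, fun x => (x.left, x.right), fun _ => rfl, fun _ => rfl⟩

/-- `GA(1,q)` for `q = p^k`: the semidirect product `F_q ⋊ F_q^×`. -/
abbrev GA1 (p k : ℕ) [Fact p.Prime] :=
  Multiplicative (GaloisField p k) ⋊[GAaction p k] (GaloisField p k)ˣ

section AffineDeterminant

open Matrix

variable {F : Type*} [Field F]

/-- Evaluation of elements of `ℤ[F]` at the additive character `x ↦ ψ (s * x)`. -/
noncomputable def evalChar (ψ : AddChar F ℂ) (s : F) : AddMonoidAlgebra ℤ F →+* ℂ :=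
  (AddMonoidAlgebra.lift ℤ ℂ F (ψ.mulShift s).toMonoidHom).toRingHom

theorem evalChar_single (ψ : AddChar F ℂ) (s t : F) (n : ℤ) :
    evalChar ψ s (AddMonoidAlgebra.single t n) = n * ψ (s * t) := by
  simp [evalChar, AddMonoidAlgebra.lift_single]

variable [Fintype F]

theorem evalChar_eq_sum (ψ : AddChar F ℂ) (s : F) (x : AddMonoidAlgebra ℤ F) :
    evalChar ψ s x = ∑ t, (x.coeff t : ℂ) * ψ (s * t) := by
  conv_lhs => rw [← AddMonoidAlgebra.sum_coeff_single x]
  rw [Finsupp.sum_fintype _ _ (by simp), map_sum]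
  simp [evalChar_single]

variable [DecidableEq F]

/-- The matrix over `ℤ[F]` of left multiplication by `∑ a b u • (b, u)` on the group ring of
`F ⋊ Fˣ`, seen as a free `ℤ[F]`-module of rank `|Fˣ|`. -/
noncomputable def affineMatrix (a : F → Fˣ → ℤ) : Matrix Fˣ Fˣ (AddMonoidAlgebra ℤ F) :=
  of fun v w => ∑ b, AddMonoidAlgebra.single ((↑v⁻¹ : F) * b) (a b (v * w⁻¹))

theorem coeff_det_affineMatrix_mul (a : F → Fˣ → ℤ) (c : Fˣ) (t : F) :
    (affineMatrix a).det.coeff (c * t) = (affineMatrix a).det.coeff t := by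
  set σ := AddMonoidAlgebra.mapDomainRingHom ℤ (AddMonoidHom.mulLeft (c : F)) with hσ
  have h : σ (affineMatrix a).det = (affineMatrix a).det := by
    rw [RingHom.map_det, ← det_submatrix_equiv_self (Equiv.mulRight c)]
    congr 1
    ext1 v w
    simp [affineMatrix, hσ, mul_assoc]
  have hc : Function.Injective (AddMonoidHom.mulLeft (c : F)) := fun x y hxy => by simpa using hxy
  conv_lhs => rw [← h]
  exact Finsupp.mapDomain_apply hc _ t

theorem coeff_det_affineMatrix (a : F → Fˣ → ℤ) {t : F} (ht : t ≠ 0) :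
    (affineMatrix a).det.coeff t = (affineMatrix a).det.coeff 1 := by
  simpa using coeff_det_affineMatrix_mul a (Units.mk0 t ht) 1

theorem evalChar_det_affineMatrix {ψ : AddChar F ℂ} (hψ : ψ.IsPrimitive) (a : F → Fˣ → ℤ)
    (s : F) :
    evalChar ψ s (affineMatrix a).det =
      ((affineMatrix a).det.coeff 0 - (affineMatrix a).det.coeff 1 : ℤ) +
        if s = 0 then (Fintype.card F * (affineMatrix a).det.coeff 1 : ℂ) else 0 := by
  set β := (affineMatrix a).det
  have h : ∀ t, (β.coeff t : ℂ) * ψ (s * t) =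
      (if t = 0 then ((β.coeff 0 - β.coeff 1 : ℤ) : ℂ) else 0) + β.coeff 1 * ψ (t * s) := by
    intro t
    split_ifs with ht
    · subst ht
      simp
    · rw [coeff_det_affineMatrix a ht, mul_comm s, zero_add]
  rw [evalChar_eq_sum, Finset.sum_congr rfl fun t _ => h t, Finset.sum_add_distrib,
    Finset.sum_ite_eq' Finset.univ, if_pos (Finset.mem_univ _), ← Finset.mul_sum, AddChar.sum_mulShift s hψ]
  split_ifs <;> simp [mul_comm]

/-- The matrix of left multiplication by `∑ a b u • (b, u)` on the group ring of `F ⋊ Fˣ`. -/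
def affineRegularMatrix (a : F → Fˣ → ℤ) : Matrix (Fˣ × F) (Fˣ × F) ℤ :=
  of fun g h => a (g.2 - ↑(g.1 * h.1⁻¹) * h.2) (g.1 * h.1⁻¹)

theorem intCast_det_affineRegularMatrix {ψ : AddChar F ℂ} (hψ : ψ.IsPrimitive)
    (a : F → Fˣ → ℤ) :
    ((affineRegularMatrix a).det : ℂ) = ∏ s, evalChar ψ s (affineMatrix a).det := by
  let T : Matrix (Fˣ × F) (Fˣ × F) ℂ :=
    of fun i g => if g.1 = i.1 then ψ (i.2 * (↑i.1⁻¹ * g.2)) else 0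
  let T' : Matrix (Fˣ × F) (Fˣ × F) ℂ :=
    of fun g i => if g.1 = i.1 then ψ (-(i.2 * (↑i.1⁻¹ * g.2))) else 0
  let M : Matrix (Fˣ × F) (Fˣ × F) ℂ :=
    blockDiagonal fun s => (evalChar ψ s).mapMatrix (affineMatrix a)
  have hTT' : T * T' = (Fintype.card F : ℂ) • 1 := by
    ext ⟨v, s⟩ ⟨w, t⟩
    simp only [T, T', mul_apply, of_apply, Fintype.sum_prod_type, Matrix.smul_apply, Matrix.one_apply,
      Prod.mk.injEq]
    rw [Finset.sum_eq_single v (fun u _ hu => by simp [hu]) (by simp)]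
    by_cases hvw : v = w
    · subst hvw
      have h : ∀ x : F, ψ (s * (↑v⁻¹ * x)) * ψ (-(t * (↑v⁻¹ * x))) =
          ψ (x * ((s - t) * ↑v⁻¹)) := fun x => by
        rw [← AddChar.map_add_eq_mul]
        congr 1
        ring
      simp only [if_true, h, AddChar.sum_mulShift _ hψ]
      simp [sub_eq_zero]
    · simp [hvw]
  have hT : T.det ≠ 0 := by
    intro h
    have := congrArg det hTT'
    rw [det_mul, h, zero_mul, det_smul, det_one, mul_one] at this
    exact pow_ne_zero _ (Nat.cast_ne_zero.2 Fintype.card_ne_zero) this.symm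
  have hTM : T * (Int.castRingHom ℂ).mapMatrix (affineRegularMatrix a) = M * T := by
    ext ⟨v, s⟩ ⟨u, b⟩
    simp only [T, M, mul_apply, of_apply, Fintype.sum_prod_type, blockDiagonal_apply,
      affineRegularMatrix, affineMatrix, RingHom.mapMatrix_apply, map_apply, map_sum,
      evalChar_single]
    rw [Finset.sum_eq_single v (fun u _ hu => by simp [hu]) (by simp),
      Finset.sum_eq_single u (fun w _ hw => by simp [hw.symm]) (by simp)]
    simp only [if_true, ite_mul, zero_mul, Finset.sum_ite_eq, Finset.mem_univ, Finset.sum_mul]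
    refine (Fintype.sum_equiv (Equiv.addRight (↑(v * u⁻¹) * b)) _ _ fun x => ?_).symm
    have h : s * (↑v⁻¹ * (x + ↑(v * u⁻¹) * b)) = s * (↑v⁻¹ * x) + s * (↑u⁻¹ * b) := by
      push_cast
      field_simp
    simp only [Equiv.coe_addRight, h, AddChar.map_add_eq_mul, add_sub_cancel_right, eq_intCast]
    ring
  have h := congrArg det hTM
  rw [det_mul, det_mul, mul_comm] at h
  have h' := mul_right_cancel₀ hT h
  rw [← RingHom.map_det, eq_intCast] at h'
  simp_rw [h', M, det_blockDiagonal, RingHom.map_det]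

theorem coeff_det_affineMatrix_eq_det (a : F → Fˣ → ℤ) :
    (affineMatrix a).det.coeff 0 - (affineMatrix a).det.coeff 1 +
      Fintype.card F * (affineMatrix a).det.coeff 1 =
    (of fun v w : Fˣ => ∑ b, a b (v * w⁻¹)).det := by
  have hψ := AddChar.FiniteField.primitiveChar_to_Complex_isPrimitive F
  have h := evalChar_det_affineMatrix hψ a 0
  rw [RingHom.map_det] at h
  have hM : (evalChar (AddChar.FiniteField.primitiveChar_to_Complex F) 0).mapMatrix
      (affineMatrix a) =
      (Int.castRingHom ℂ).mapMatrix (of fun v w : Fˣ => ∑ b, a b (v * w⁻¹)) := by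
    ext v w
    simp [affineMatrix, evalChar_single]
  rw [hM, ← RingHom.map_det, eq_intCast, if_pos rfl] at h
  exact_mod_cast h.symm

theorem det_affineRegularMatrix (a : F → Fˣ → ℤ) :
    (affineRegularMatrix a).det = (of fun v w : Fˣ => ∑ b, a b (v * w⁻¹)).det *
      ((affineMatrix a).det.coeff 0 - (affineMatrix a).det.coeff 1) ^ (Fintype.card F - 1) := by
  have hψ := AddChar.FiniteField.primitiveChar_to_Complex_isPrimitive F
  have h := intCast_det_affineRegularMatrix hψ a
  rw [Fintype.prod_eq_mul_prod_compl 0, Finset.prod_congr rfl (g := fun _ =>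
    (((affineMatrix a).det.coeff 0 - (affineMatrix a).det.coeff 1 : ℤ) : ℂ)) (fun s hs => by
      rw [evalChar_det_affineMatrix hψ, if_neg (by simpa using hs), add_zero]),
    evalChar_det_affineMatrix hψ, if_pos rfl, Finset.prod_const, Finset.card_compl,
    Finset.card_singleton] at h
  rw [← coeff_det_affineMatrix_eq_det]
  exact_mod_cast h

end AffineDeterminant

theorem groupDet_eq_det_of_equiv {G ι : Type*} [Group G] [Finite G] [Fintype ι] [DecidableEq ι]
    (e : ι ≃ G) (a : G → ℤ) :
    groupDet G a = (Matrix.of fun i j => a (e i * (e j)⁻¹)).det :=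
  letI : Fintype G := Fintype.ofFinite G
  letI : DecidableEq G := Classical.decEq G
  (Matrix.det_submatrix_equiv_self e (Matrix.of fun g h : G => a (g * h⁻¹))).symm

theorem isCirculantDet_of_isCyclic {G : Type*} [CommGroup G] [IsCyclic G] [Fintype G]
    [DecidableEq G] {m : ℕ} (hm : Fintype.card G = m) (c : G → ℤ) :
    IsCirculantDet m (Matrix.of fun v w : G => c (v * w⁻¹)).det := by
  obtain _ | n := m
  · exact absurd hm Fintype.card_ne_zero
  have hG : Nat.card G = n + 1 := by rw [Nat.card_eq_fintype_card, hm]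
  obtain ⟨g, hg⟩ := IsCyclic.exists_generator (α := G)
  let e : Multiplicative (Fin (n + 1)) ≃* G := zmodMulEquivOfGenerator hg hG
  refine ⟨fun i => c (e (Multiplicative.ofAdd i)), ?_⟩
  rw [← Matrix.det_submatrix_equiv_self (Multiplicative.ofAdd.trans e.toEquiv)]
  congr 1
  ext i j
  simp [Matrix.circulant_apply, ofAdd_sub, div_eq_mul_inv]

/-- Every integer group determinant of `GA(1,p^k)` has the form `A * B^(q-1)` where
`A` is a `ℤ_{q-1}` integer group determinant and `B ≡ A (mod q)`. -/
theorem stmt0 (p k q : ℕ) [Fact p.Prime] (hk : 1 ≤ k) (hq : q = p ^ k) (D : ℤ)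
    (hD : IsIntGroupDet (GA1 p k) D) :
    ∃ A B : ℤ, IsCirculantDet (q - 1) A ∧ B ≡ A [ZMOD (q : ℤ)] ∧ D = A * B ^ (q - 1) := by
  classical
  obtain ⟨a, rfl⟩ := hD
  let _ : Fintype (GaloisField p k) := Fintype.ofFinite _
  have hcard : Fintype.card (GaloisField p k) = q := by
    rw [← Nat.card_eq_fintype_card, GaloisField.card p k (by lia), hq]
  let e : (GaloisField p k)ˣ × GaloisField p k ≃ GA1 p k :=
    ⟨fun x => ⟨Multiplicative.ofAdd x.2, x.1⟩, fun g => (g.right, g.left.toAdd),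
      fun _ => rfl, fun _ => rfl⟩
  have he_left (x) : (e x).left = Multiplicative.ofAdd x.2 := rfl
  have he_right (x) : (e x).right = x.1 := rfl
  let a' : GaloisField p k → (GaloisField p k)ˣ → ℤ := fun b u => a (e (u, b))
  have hdet : groupDet (GA1 p k) a = (affineRegularMatrix a').det := by
    rw [groupDet_eq_det_of_equiv e]
    refine congrArg Matrix.det (Matrix.ext fun g h => congrArg a ?_)
    apply SemidirectProduct.ext
    · apply Multiplicative.toAdd.injective
      simp [he_left, he_right, GAaction, Units.smul_def, sub_eq_add_neg, mul_assoc]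
    · simp [he_right]
  refine ⟨_, (affineMatrix a').det.coeff 0 - (affineMatrix a').det.coeff 1,
    isCirculantDet_of_isCyclic (by rw [Fintype.card_units, hcard]) fun u => ∑ b, a' b u, ?_, ?_⟩
  · rw [← coeff_det_affineMatrix_eq_det, hcard]
    simp [Int.ModEq]
  · rw [hdet, det_affineRegularMatrix, hcard]
end

section
/- Let p be a prime, k ≥ 1, and q = p^k. For all integers A and B with gcd(A, q−1) = 1 and B ≡ A (mod q), the integer A·B^(q−1) is an integer group determinant of GA(1,q). -/
section

open Matrix

/-- The determinant of `x • 1 + c • J`, where `J` is the all-ones matrix. -/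
theorem det_scalar_add_smul_ones {n R : Type*} [Fintype n] [DecidableEq n] [Nonempty n]
    [CommRing R] (x c : R) :
    (scalar n x + c • (of fun _ _ => 1 : Matrix n n R)).det =
      x ^ (Fintype.card n - 1) * (x + c * Fintype.card n) := by
  have h := eval_charpoly (vecMulVec (fun _ : n => -c) (fun _ : n => (1 : R))) x
  rw [charpoly_vecMulVec] at h
  have e : scalar n x + c • (of fun _ _ => 1 : Matrix n n R) =
      scalar n x - vecMulVec (fun _ : n => -c) (fun _ : n => (1 : R)) := by
    ext i j
    simp [vecMulVec_apply]
  rw [e, ← h]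
  obtain ⟨m, hm⟩ := Nat.exists_eq_succ_of_ne_zero (Fintype.card_ne_zero (α := n))
  simp [dotProduct, hm]
  ring

theorem scalar_eq_smul_one {n R : Type*} [Fintype n] [DecidableEq n] [CommSemiring R] (x : R) :
    scalar n x = x • (1 : Matrix n n R) := by
  rw [scalar_apply, smul_one_eq_diagonal]

/-- If all row sums of `X` vanish, then `det (X + A • J) = A * det (X + J)`. -/
theorem det_add_smul_ones {n : Type*} [Fintype n] [DecidableEq n] [Nonempty n]
    (X : Matrix n n ℤ) (hX : X * (of fun _ _ => 1 : Matrix n n ℤ) = 0) (A : ℤ) :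
    (X + A • (of fun _ _ => 1 : Matrix n n ℤ)).det =
      A * (X + (of fun _ _ => 1 : Matrix n n ℤ)).det := by
  set J : Matrix n n ℤ := of fun _ _ => 1 with hJ
  set m : ℤ := (Fintype.card n : ℤ) with hm
  have hm0 : m ≠ 0 := by simp [hm]
  have hJJ : J * J = m • J := by
    ext i j
    simp [hJ, mul_apply, hm]
  have key : (X + J) * (scalar n m + (A - 1) • J) = m • (X + A • J) := by
    rw [scalar_eq_smul_one, add_mul, mul_add, mul_add, mul_smul_comm, mul_smul_comm, hX, mul_smul_comm,
      mul_smul_comm, hJJ, mul_one, mul_one]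
    module
  have hd := congrArg det key
  rw [det_mul, det_scalar_add_smul_ones, det_smul] at hd
  obtain ⟨r, hr⟩ := Nat.exists_eq_succ_of_ne_zero (Fintype.card_ne_zero (α := n))
  apply mul_left_cancel₀ (pow_ne_zero (Fintype.card n) hm0)
  rw [← hd, ← hm, hr]
  simp only [Nat.succ_eq_add_one, Nat.add_sub_cancel, pow_succ]
  ring

/-- The matrix of left translation by `g`. -/
def translationMatrix {H : Type*} [Group H] [DecidableEq H] (g : H) : Matrix H H ℤ :=
  of fun x y => if x = g * y then 1 else 0

theorem translationMatrix_mul {H : Type*} [Group H] [Fintype H] [DecidableEq H] (g h : H) :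
    translationMatrix (g * h) = translationMatrix g * translationMatrix h := by
  ext x y
  simp [translationMatrix, mul_apply, mul_assoc]

theorem translationMatrix_one {H : Type*} [Group H] [DecidableEq H] :
    translationMatrix (1 : H) = 1 := by
  ext x y
  simp [translationMatrix, one_apply]

theorem translationMatrix_pow {H : Type*} [Group H] [Fintype H] [DecidableEq H] (g : H)
    (n : ℕ) : translationMatrix (g ^ n) = translationMatrix g ^ n := by
  induction n with
  | zero => simp [translationMatrix_one]
  | succ n ih => rw [pow_succ, pow_succ, translationMatrix_mul, ih]

theorem translationMatrix_mul_ones {H : Type*} [Group H] [Fintype H] [DecidableEq H] (g : H) :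
    translationMatrix g * (of fun _ _ => 1 : Matrix H H ℤ) = of fun _ _ => 1 := by
  ext x y
  have : ∀ j : H, x = g * j ↔ g⁻¹ * x = j := fun j => by
    rw [inv_mul_eq_iff_eq_mul]
  simp [translationMatrix, mul_apply, this]

theorem ones_mul_translationMatrix {H : Type*} [Group H] [Fintype H] [DecidableEq H] (g : H) :
    (of fun _ _ => 1 : Matrix H H ℤ) * translationMatrix g = of fun _ _ => 1 := by
  ext x y
  simp [translationMatrix, mul_apply]

theorem det_translationMatrix_sub_one_add_ones_ne_zero {H : Type*} [Group H] [Fintype H]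
    [DecidableEq H] (g : H) (hg : ∀ x, x ∈ Subgroup.zpowers g) :
    (translationMatrix g - 1 + (of fun _ _ => 1 : Matrix H H ℤ)).det ≠ 0 := by
  intro h
  obtain ⟨v, hv0, hv⟩ := exists_mulVec_eq_zero_iff.mpr h
  apply hv0
  have h1 : ∀ x, v (g⁻¹ * x) - v x + ∑ y, v y = 0 := fun x => by
    have := congrFun hv x
    have e : ∀ j : H, x = g * j ↔ g⁻¹ * x = j := fun j => by
      rw [inv_mul_eq_iff_eq_mul]
    simpa [mulVec, dotProduct, add_mul, sub_mul, Finset.sum_add_distrib, translationMatrix, e,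
      one_apply] using this
  have h2 : ∑ y, v y = 0 := by
    have := Finset.sum_congr rfl fun x (_ : x ∈ Finset.univ) => h1 x
    rw [Finset.sum_add_distrib, Finset.sum_sub_distrib,
      show ∑ x, v (g⁻¹ * x) = ∑ x, v x from Equiv.sum_comp (Equiv.mulLeft g⁻¹) v] at this
    simpa using this
  have h3 : ∀ x, v (g * x) = v x := fun x => by
    have := h1 (g * x)
    rw [h2, inv_mul_cancel_left] at this
    linarith
  have h4 : ∀ x, v x = v 1 := fun x => by
    obtain ⟨n, -, rfl⟩ := (mem_zpowers_iff_mem_range_orderOf.trans Finset.mem_image).mp (hg x)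
    induction n with
    | zero => simp
    | succ n ih => rw [pow_succ', h3, ih]
  have h5 : v 1 = 0 := by
    rw [Finset.sum_congr rfl fun x _ => h4 x] at h2
    simpa using h2
  ext x
  rw [h4, h5]
  rfl

theorem det_translationMatrix_pow {H : Type*} [CommGroup H] [Fintype H] [DecidableEq H] (g : H)
    (n : ℕ) (hn : (Nat.card H).Coprime n) :
    (translationMatrix (g ^ n) - 1 + (of fun _ _ => 1 : Matrix H H ℤ)).det =
      (translationMatrix g - 1 + (of fun _ _ => 1 : Matrix H H ℤ)).det := by
  rw [← det_submatrix_equiv_self (powCoprime hn)]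
  congr 1
  ext x y
  have : x ^ n = g ^ n * y ^ n ↔ x = g * y := by
    rw [← mul_pow]
    exact (powCoprime hn).injective.eq_iff
  have h1 : x ^ n = y ^ n ↔ x = y := (powCoprime hn).injective.eq_iff
  simp [translationMatrix, this, h1, one_apply]

/-- Every integer coprime to the order of a finite cyclic group is a group determinant of it,
realised by a family whose sum is that integer. -/
theorem exists_det_eq_and_sum_eq {H : Type*} [CommGroup H] [Fintype H] [DecidableEq H]
    [IsCyclic H] (A : ℤ) (hA : Int.gcd A (Fintype.card H) = 1) :
    ∃ f : H → ℤ, (of fun x y => f (x * y⁻¹) : Matrix H H ℤ).det = A ∧ ∑ x, f x = A := by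
  obtain ⟨g, hg⟩ := IsCyclic.exists_generator (α := H)
  set m : ℤ := (Fintype.card H : ℤ) with hm
  have hm0 : 0 < m := by rw [hm]; exact_mod_cast Fintype.card_pos
  obtain ⟨n, hn⟩ := Int.eq_ofNat_of_zero_le (Int.emod_nonneg A hm0.ne')
  have hdiv : (n : ℤ) + A / m * m = A := by
    rw [← hn]; exact Int.emod_add_ediv_mul A m
  have hcop : (Nat.card H).Coprime n := by
    rw [Nat.card_eq_fintype_card, Nat.coprime_comm, Nat.Coprime, ← Int.gcd_natCast_natCast,
      ← hm, ← hA, ← hdiv]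
    simp
  set s : ℤ := A / m
  refine ⟨fun h => (∑ j ∈ Finset.range n, if h = g ^ j then 1 else 0) + s, ?_, ?_⟩
  · have hC : (of fun x y : H => (∑ j ∈ Finset.range n, if x * y⁻¹ = g ^ j then (1 : ℤ) else 0)
        + s) = (∑ j ∈ Finset.range n, translationMatrix g ^ j) +
          s • (of fun _ _ => 1 : Matrix H H ℤ) := by
      ext x y
      simp only [← translationMatrix_pow]
      simp [translationMatrix, Matrix.sum_apply, mul_inv_eq_iff_eq_mul]
    rw [hC]
    set J : Matrix H H ℤ := of fun _ _ => 1 with hJ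
    have hJJ : J * J = m • J := by
      ext i j
      simp [hJ, mul_apply, hm]
    have hJP : ∀ j : ℕ, J * translationMatrix g ^ j = J := fun j => by
      rw [← translationMatrix_pow]; exact ones_mul_translationMatrix _
    have hPJ : ∀ h : H, (translationMatrix h - 1) * J = 0 := fun h => by
      rw [sub_mul, one_mul, translationMatrix_mul_ones, sub_self]
    have key : (translationMatrix g - 1 + J) *
        ((∑ j ∈ Finset.range n, translationMatrix g ^ j) + s • J) =
        translationMatrix (g ^ n) - 1 + A • J := by
      rw [add_mul, mul_add, mul_add, mul_geom_sum, mul_smul_comm, mul_smul_comm, hPJ, hJJ,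
        Finset.mul_sum, Finset.sum_congr rfl fun j _ => hJP j, translationMatrix_pow, ← hdiv]
      simp only [Finset.sum_const, Finset.card_range]
      module
    have hd := congrArg det key
    rw [det_mul, det_add_smul_ones _ (hPJ _), det_translationMatrix_pow g n hcop, mul_comm] at hd
    exact mul_right_cancel₀ (det_translationMatrix_sub_one_add_ones_ne_zero g hg) hd
  · rw [Finset.sum_add_distrib, Finset.sum_comm]
    simp only [Finset.sum_ite_eq', Finset.mem_univ, if_true]
    simp only [Finset.sum_const, Finset.card_range, Finset.card_univ]
    rw [← hdiv, hm]
    simp [mul_comm]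

/-- The determinant of the matrix of `f + t • (1 - n) * S` on `GA(1, F)`, where `f` is supported on
`Fˣ`, `n` is the translation by `1` and `S` is the sum of all elements of `Fˣ`. -/
theorem det_affine {F : Type*} [Field F] [Fintype F] [DecidableEq F]
    (f : Fˣ → ℤ) (A t : ℤ) (hA : A ≠ 0)
    (hdet : (of fun x y => f (x * y⁻¹) : Matrix Fˣ Fˣ ℤ).det = A) (hsum : ∑ x, f x = A) :
    (of fun x y : F × Fˣ => (if x.1 = y.1 then f (x.2 * y.2⁻¹) else 0) +
      t * ((if x.1 = y.1 then 1 else 0) - if (x.2 : F) * (x.1 - y.1) = 1 then 1 else 0) :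
        Matrix (F × Fˣ) (F × Fˣ) ℤ).det =
      A * (A + t * Fintype.card F) ^ (Fintype.card F - 1) := by
  set M := (of fun x y : F × Fˣ => (if x.1 = y.1 then f (x.2 * y.2⁻¹) else 0) +
      t * ((if x.1 = y.1 then 1 else 0) - if (x.2 : F) * (x.1 - y.1) = 1 then 1 else 0) :
        Matrix (F × Fˣ) (F × Fˣ) ℤ) with hM
  set C : Matrix Fˣ Fˣ ℤ := of fun x y => f (x * y⁻¹) with hC
  set W : Matrix (F × Fˣ) F ℤ := of fun x m =>
    -t * ((if x.1 = m then 1 else 0) - if (x.2 : F) * (x.1 - m) = 1 then 1 else 0) with hW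
  set R : Matrix F (F × Fˣ) ℤ := of fun m y => if m = y.1 then 1 else 0 with hR
  set K : Matrix (F × Fˣ) (F × Fˣ) ℤ := kroneckerMap (· * ·) (1 : Matrix F F ℤ) C with hK
  have hcol : ∀ y : Fˣ, ∑ x, f (x * y⁻¹) = A := fun y => by
    rw [← hsum]; exact Equiv.sum_comp (Equiv.mulRight y⁻¹) f
  have hRK : R * K = A • R := by
    ext m y
    rw [mul_apply, Fintype.sum_prod_type]
    simp only [hR, hK, hC, of_apply, kroneckerMap_apply, ite_mul, one_mul, zero_mul, one_apply,
      Matrix.smul_apply, smul_eq_mul]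
    rw [Finset.sum_comm]
    simp only [Finset.sum_ite_eq, Finset.mem_univ, if_true]
    by_cases h : m = y.1 <;> simp [h, hcol]
  have hWR : M = K - W * R := by
    ext x y
    simp [hM, hK, hW, hR, hC, mul_apply, kroneckerMap_apply, one_apply]
  have hfac : A • M = (scalar (F × Fˣ) A - W * R) * K := by
    rw [sub_mul, Matrix.mul_assoc, hRK, hWR, Matrix.mul_smul, smul_sub, scalar_eq_smul_one,
      Matrix.smul_mul, one_mul]
  have hRW : scalar F A - R * W =
      scalar F (A + t * Fintype.card F) + (-t) • (of fun _ _ => 1 : Matrix F F ℤ) := by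
    ext m m'
    have hq : (Fintype.card F : ℤ) = Fintype.card Fˣ + 1 := by
      rw [Fintype.card_eq_card_units_add_one]; simp
    have hcount : ∑ u : Fˣ, (if (u : F) * (m - m') = 1 then (1 : ℤ) else 0) =
        if m = m' then 0 else 1 := by
      by_cases h : m = m'
      · simp [h]
      · have h' : m - m' ≠ 0 := sub_ne_zero.mpr h
        have e : ∀ u : Fˣ, (u : F) * (m - m') = 1 ↔ u = (Units.mk0 _ h')⁻¹ := fun u => by
          rw [eq_inv_iff_mul_eq_one, Units.ext_iff]; simp
        simp [e, h]
    have hent : (R * W) m m' = -t * ((if m = m' then (Fintype.card Fˣ : ℤ) else 0) -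
        if m = m' then 0 else 1) := by
      rw [mul_apply, Fintype.sum_prod_type, Finset.sum_comm]
      simp only [hR, hW, of_apply, ite_mul, one_mul, zero_mul, Finset.sum_ite_eq,
        Finset.mem_univ, if_true]
      rw [← Finset.mul_sum, Finset.sum_sub_distrib, hcount]
      by_cases h : m = m' <;> simp [h]
    rw [Matrix.sub_apply, Matrix.add_apply, hent, scalar_eq_smul_one A, scalar_eq_smul_one (A + _)]
    simp only [Matrix.smul_apply, of_apply, one_apply, smul_eq_mul]
    by_cases h : m = m'
    · simp [h, hq]
      ring
    · simp [h]
  have hcomm := congrArg (Polynomial.eval A) (charpoly_mul_comm' W R)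
  simp only [Polynomial.eval_mul, Polynomial.eval_pow, Polynomial.eval_X, eval_charpoly] at hcomm
  rw [hRW, det_scalar_add_smul_ones] at hcomm
  have hd := congrArg det hfac
  have hKdet : K.det = A ^ Fintype.card F := by
    rw [hK, det_kronecker, hdet]; simp
  rw [det_smul, det_mul, hKdet, mul_comm (det _), hcomm] at hd
  have := mul_left_cancel₀ (pow_ne_zero _ hA) hd
  rw [this]
  ring

/-- The elements of `GA(1,q)` written as products of an element of `F_q^×` and a translation. -/
noncomputable def GA1.equivProd (p k : ℕ) [Fact p.Prime] :
    GaloisField p k × (GaloisField p k)ˣ ≃ GA1 p k where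
  toFun x := ⟨Multiplicative.ofAdd (x.2 • x.1), x.2⟩
  invFun g := (g.right⁻¹ • g.left.toAdd, g.right)
  left_inv x := by simp
  right_inv g := by ext <;> simp

theorem groupDet_eq_det {G ι : Type*} [Group G] [Finite G] [Fintype ι] [DecidableEq ι]
    (e : ι ≃ G) (a : G → ℤ) :
    groupDet G a = (of fun x y => a (e x * (e y)⁻¹) : Matrix ι ι ℤ).det := by
  let _ : Fintype G := Fintype.ofFinite G
  let _ : DecidableEq G := Classical.decEq G
  exact (det_submatrix_equiv_self e (of fun g h : G => a (g * h⁻¹))).symm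

theorem GA1.equivProd_left {p k : ℕ} [Fact p.Prime] (x : GaloisField p k × (GaloisField p k)ˣ) :
    (GA1.equivProd p k x).left = Multiplicative.ofAdd (x.2 • x.1) :=
  rfl

theorem GA1.equivProd_right {p k : ℕ} [Fact p.Prime] (x : GaloisField p k × (GaloisField p k)ˣ) :
    (GA1.equivProd p k x).right = x.2 :=
  rfl

end

/-- If `gcd(A, q-1) = 1` and `B ≡ A (mod q)`, then `A * B^(q-1)` is an integer group
determinant of `GA(1,q)`. -/
theorem stmt1 (p k q : ℕ) [Fact p.Prime] (hk : 1 ≤ k) (hq : q = p ^ k)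
    (A B : ℤ) (hA : Int.gcd A ((q : ℤ) - 1) = 1) (hB : B ≡ A [ZMOD (q : ℤ)]) :
    IsIntGroupDet (GA1 p k) (A * B ^ (q - 1)) := by
  subst hq
  classical
  let _ : Fintype (GaloisField p k) := Fintype.ofFinite _
  by_cases hA0 : A = 0
  · refine ⟨0, ?_⟩
    rw [hA0, zero_mul, groupDet_eq_det (GA1.equivProd p k)]
    exact Matrix.det_eq_zero_of_row_eq_zero (0, 1) fun _ => rfl
  have hcard : Fintype.card (GaloisField p k) = p ^ k := by
    rw [← Nat.card_eq_fintype_card, GaloisField.card p k (by omega)]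
  have hunits : ((Fintype.card (GaloisField p k)ˣ : ℕ) : ℤ) = ((p ^ k : ℕ) : ℤ) - 1 := by
    rw [← hcard, Fintype.card_eq_card_units_add_one (α := GaloisField p k)]
    simp
  obtain ⟨f, hdet, hsum⟩ := exists_det_eq_and_sum_eq (H := (GaloisField p k)ˣ) A (hunits ▸ hA)
  obtain ⟨t, ht⟩ := hB.symm.dvd
  have hB' : B = A + t * Fintype.card (GaloisField p k) := by
    rw [hcard]; linarith
  have hmain := det_affine f A t hA0 hdet hsum
  rw [← hB', hcard] at hmain
  refine ⟨fun g => (if g.left.toAdd = 0 then f g.right else 0) +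
    t * ((if g.left.toAdd = 0 then 1 else 0) - if g.left.toAdd = 1 then 1 else 0), ?_⟩
  rw [groupDet_eq_det (GA1.equivProd p k), ← hmain]
  congr 1
  ext x y
  have hl : (GA1.equivProd p k x * (GA1.equivProd p k y)⁻¹).left.toAdd =
      (x.2 : GaloisField p k) * (x.1 - y.1) := by
    simp [GA1.equivProd_left, GA1.equivProd_right, GAaction, Units.smul_def, mul_add,
      sub_eq_add_neg]
  have hr : (GA1.equivProd p k x * (GA1.equivProd p k y)⁻¹).right = x.2 * y.2⁻¹ := by
    simp [GA1.equivProd_right]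
  simp only [Matrix.of_apply, hl, hr, mul_eq_zero, Units.ne_zero, false_or,
    sub_eq_zero]
end

section
/- The set of integer group determinants of GA(1,9) is exactly the set of integers of the form A·B^8 where A and B are integers, either A is odd or 2^5 divides A, and B ≡ A (mod 9). -/
namespace GroupDetGA9

open Matrix

/-- A concrete model of the field with nine elements, `𝔽₃[γ]` with `γ² = γ + 1`. -/
abbrev F9 := QuadraticAlgebra (ZMod 3) 1 1

/-- The Eisenstein integers `ℤ[ω]` with `ω² = -ω - 1`. -/
abbrev Eis := QuadraticAlgebra ℤ (-1) (-1)

/-- The ring `(ℤ/9)[ζ, ω]` with `ζ² = 4ζ + 1` (so that `ζ` has order `8`) and `ω² = -ω - 1`. -/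
abbrev W9 := QuadraticAlgebra (QuadraticAlgebra (ZMod 9) 1 4) (-1) (-1)

/-- The ring `ℤ[ζ₈]`, as a tower of quadratic extensions `ℤ ⊂ ℤ[i] ⊂ ℤ[ζ₈]`. -/
abbrev Z8 := QuadraticAlgebra (QuadraticAlgebra ℤ (-1) 0) ⟨0, 1⟩ 0

instance : Fintype F9 := Fintype.ofEquiv _ (QuadraticAlgebra.equivProd 1 1).symm

instance : Fact (∀ r : ZMod 3, r ^ 2 ≠ 1 + 1 * r) := ⟨by decide⟩

/-- The powers of the generator `γ` of `F9ˣ`. -/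
def e (t : ZMod 8) : F9 := (⟨0, 1⟩ : F9) ^ t.val

/-- A nontrivial additive character of `F9`. -/
def psi (x : F9) : Eis := (⟨0, 1⟩ : Eis) ^ x.re.val

/-- The Teichmüller character, on exponents. -/
def T (t : ZMod 8) : W9 := (⟨⟨0, 1⟩, 0⟩ : W9) ^ t.val

/-- The character of `ZMod 8` sending `1` to `ζ₈`. -/
def chi (t : ZMod 8) : Z8 := (⟨0, 1⟩ : Z8) ^ t.val

lemma e_add : ∀ s t, e (s + t) = e s * e t := by decide +kernel

lemma e_zero : e 0 = 1 := by decide +kernel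

lemma e_ne_zero : ∀ t, e t ≠ 0 := by decide +kernel

lemma exists_e : ∀ x : F9, x ≠ 0 → ∃ t, e t = x := by decide +kernel

lemma e_injective : Function.Injective e := by unfold Function.Injective; decide +kernel

lemma psi_add : ∀ x y, psi (x + y) = psi x * psi y := by decide +kernel

lemma psi_zero : psi 0 = 1 := by decide +kernel

lemma sum_psi : ∀ x : F9, ∑ y, psi (x * y) = if x = 0 then 9 else 0 := by decide +kernel

lemma sum_psi_units : ∀ x : F9, ∑ u, psi (e (-u) * x) = if x = 0 then 8 else -1 := by
  decide +kernel

lemma psi_neg_eq_star : ∀ x, psi (-x) = star (psi x) := by decide +kernel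

lemma e_four : e 4 = -1 := by decide +kernel

lemma T_add : ∀ s t, T (s + t) = T s * T t := by decide +kernel

lemma chi_add : ∀ s t, chi (s + t) = chi s * chi t := by decide +kernel

lemma sum_T : ∀ k : ZMod 8, ∑ u, T (u * k) = if k = 0 then 8 else 0 := by decide +kernel

lemma sum_chi : ∀ k : ZMod 8, ∑ u, chi (u * k) = if k = 0 then 8 else 0 := by decide +kernel

/-- Multiplication by `e t` as a permutation of `F9`. -/
def mulE (t : ZMod 8) : F9 ≃ F9 where
  toFun x := e t * x
  invFun x := e (-t) * x
  left_inv x := by dsimp only; rw [← mul_assoc, ← e_add]; simp [e_zero]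
  right_inv x := by dsimp only; rw [← mul_assoc, ← e_add]; simp [e_zero]

/-- Every element of `F9` is zero or a power of the generator. -/
noncomputable def optionEquiv : Option (ZMod 8) ≃ F9 :=
  Equiv.ofBijective (fun o => o.elim 0 e) <| by
    constructor
    · rintro (_ | s) (_ | t) h
      · rfl
      · exact absurd h.symm (e_ne_zero t)
      · exact absurd h (e_ne_zero s)
      · exact congrArg some (e_injective h)
    · intro x
      by_cases hx : x = 0
      · exact ⟨none, hx.symm⟩
      · obtain ⟨t, rfl⟩ := exists_e x hx
        exact ⟨some t, rfl⟩

lemma prod_F9 {M : Type*} [CommMonoid M] (f : F9 → M) :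
    ∏ x, f x = f 0 * ∏ t, f (e t) := by
  rw [← optionEquiv.prod_comp, Fintype.prod_option]
  rfl

/-! ### Linear algebra -/

lemma det_eq_of_mul_eq_mul {n R : Type*} [Fintype n] [DecidableEq n] [CommRing R]
    {A B P Q : Matrix n n R} {c : R} (hc : IsRegular c) (hQP : Q * P = c • 1)
    (h : A * P = P * B) : A.det = B.det := by
  have h1 : Q.det * P.det = c ^ Fintype.card n := by
    rw [← det_mul, hQP, det_smul, det_one, mul_one]
  have h2 : A.det * P.det = P.det * B.det := by rw [← det_mul, h, det_mul]
  have h3 : c ^ Fintype.card n * A.det = c ^ Fintype.card n * B.det := by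
    rw [← h1]; linear_combination Q.det * h2
  exact (hc.pow _).left h3

lemma det_mul_mul_eq {n R : Type*} [Fintype n] [DecidableEq n] [CommRing R]
    (Q M P : Matrix n n R) : (Q * M * P).det = (Q * P).det * M.det := by
  simp only [det_mul]
  ring

/-- The rank-one update formula in terms of a scaled inverse. -/
lemma det_add_vecMulVec_of_mul_eq {n R : Type*} [Fintype n] [DecidableEq n] [CommRing R]
    {M C : Matrix n n R} {D : R} (hD : IsRegular D) (hdet : M.det = D)
    (hMC : M * C = D • 1) (u v : n → R) :
    (M + vecMulVec u v).det = D + v ⬝ᵥ C *ᵥ u := by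
  have key : fromBlocks M (replicateCol Unit (-u)) (replicateRow Unit v) 1 *
      fromBlocks 1 (replicateCol Unit (C *ᵥ u)) 0 (D • 1) =
      fromBlocks M 0 (replicateRow Unit v) ((D + v ⬝ᵥ C *ᵥ u) • 1) := by
    rw [fromBlocks_multiply]
    congr 1
    · simp
    · rw [← Matrix.replicateCol_mulVec, mulVec_mulVec, hMC]
      ext i j
      simp [smul_mulVec]
    · simp
    · rw [replicateRow_mul_replicateCol]
      ext i j
      simp [add_comm]
  have h := congrArg det key
  rw [det_mul, det_fromBlocks_one₂₂, det_fromBlocks_zero₂₁, det_fromBlocks_zero₁₂, hdet,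
    show M - replicateCol Unit (-u) * replicateRow Unit v = M + vecMulVec u v by
      ext i j; simp [vecMulVec_apply, Matrix.mul_apply]] at h
  simp only [det_one, det_smul, Fintype.card_unit, pow_one, one_mul, mul_one] at h
  exact hD.left ((mul_comm _ _).trans h)

/-! ### Factorization of the group determinant -/

/-- The group matrix of `GA(1,9)` in the coordinates `(u, x) ↦ (e u * x, e u)`. -/
def groupMatrix (a : F9 → ZMod 8 → ℤ) : Matrix (ZMod 8 × F9) (ZMod 8 × F9) ℤ :=
  of fun p q => a (e p.1 * (p.2 - q.2)) (p.1 - q.1)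

/-- The image of the group ring element `a` under the representation of `GA(1,9)` induced from
the additive character `z ↦ psi (w * z)`. -/
def repMatrix (a : F9 → ZMod 8 → ℤ) (w : F9) : Matrix (ZMod 8) (ZMod 8) Eis :=
  of fun u v => ∑ z, psi (w * z) * a (e u * z) (u - v)

/-- The image of the group ring element `a` in the group ring of `ZMod 8`. -/
def pushforward (a : F9 → ZMod 8 → ℤ) (t : ZMod 8) : ℤ := ∑ z, a z t

lemma isRegular_intCast_quadraticAlgebra {R : Type*} [CommRing R] {a b : R} {n : ℤ}
    (hn : IsRegular (n : R)) : IsRegular (n : QuadraticAlgebra R a b) := by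
  rw [← isLeftRegular_iff_isRegular]
  intro x y h
  have h : (n : QuadraticAlgebra R a b) * x = n * y := h
  rw [QuadraticAlgebra.ext_iff] at h ⊢
  simp only [QuadraticAlgebra.re_mul, QuadraticAlgebra.im_mul, QuadraticAlgebra.re_intCast,
    QuadraticAlgebra.im_intCast, zero_mul, mul_zero, add_zero] at h
  exact ⟨hn.left h.1, hn.left h.2⟩

lemma isRegular_intCast_eis {n : ℤ} (hn : n ≠ 0) : IsRegular (n : Eis) :=
  isRegular_intCast_quadraticAlgebra (IsRegular.of_ne_zero hn)

lemma det_groupMatrix_eq_prod (a : F9 → ZMod 8 → ℤ) :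
    ((groupMatrix a).det : Eis) = ∏ w, (repMatrix a w).det := by
  have h := det_eq_of_mul_eq_mul (A := (groupMatrix a).map (Int.cast : ℤ → Eis))
    (B := blockDiagonal (repMatrix a))
    (P := of fun p q : ZMod 8 × F9 => if p.1 = q.1 then psi (-(q.2 * p.2)) else 0)
    (Q := of fun p q : ZMod 8 × F9 => if p.1 = q.1 then psi (p.2 * q.2) else 0)
    (isRegular_intCast_eis (n := 9) (by norm_num)) ?_ ?_
  · rw [det_blockDiagonal] at h
    rw [← h]
    exact (Int.castRingHom Eis).map_det _
  · ext1 ⟨u, w⟩ ⟨v, w'⟩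
    simp only [Matrix.mul_apply, of_apply, Fintype.sum_prod_type, Matrix.smul_apply, one_apply,
      Prod.mk.injEq]
    by_cases huv : u = v
    · subst huv
      have : ∀ x, psi (w * x) * psi (-(w' * x)) = psi ((w - w') * x) := fun x => by
        rw [← psi_add]; congr 1; ring
      rw [Finset.sum_eq_single u (by intro s _ hs; simp [hs.symm]) (by simp)]
      simp only [if_true, this, sum_psi, sub_eq_zero, true_and]
      split_ifs <;> simp
    · simp only [huv, false_and, if_false, smul_zero]
      refine Finset.sum_eq_zero fun s _ => Finset.sum_eq_zero fun x _ => ?_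
      by_cases hs : u = s
      · subst hs; simp [huv]
      · simp [hs]
  · ext1 ⟨u, x⟩ ⟨v, w⟩
    simp only [Matrix.mul_apply, of_apply, Fintype.sum_prod_type, map_apply, groupMatrix,
      blockDiagonal_apply, repMatrix]
    rw [Finset.sum_eq_single v (by intro s _ hs; simp [hs]) (by simp),
      Finset.sum_eq_single u (by intro s _ hs; simp [hs.symm]) (by simp)]
    simp only [if_true, mul_ite, mul_zero, Finset.sum_ite_eq', Finset.mem_univ, Finset.mul_sum]
    rw [← (Equiv.subLeft x).sum_comp]
    refine Finset.sum_congr rfl fun z _ => ?_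
    simp only [Equiv.subLeft_apply, sub_sub_cancel]
    rw [show -(w * (x - z)) = -(w * x) + w * z by ring, psi_add]
    ring

lemma det_repMatrix_e (a : F9 → ZMod 8 → ℤ) (n : ZMod 8) :
    (repMatrix a (e n)).det = (repMatrix a 1).det := by
  rw [← det_submatrix_equiv_self (Equiv.subRight n) (repMatrix a 1)]
  congr 1
  ext1 u v
  simp only [repMatrix, submatrix_apply, of_apply, Equiv.subRight_apply, sub_sub_sub_cancel_right]
  conv_rhs => rw [← (mulE n).sum_comp]
  refine Finset.sum_congr rfl fun z _ => ?_
  change _ = psi (1 * (e n * z)) * a (e (u - n) * (e n * z)) _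
  rw [one_mul, ← mul_assoc, ← e_add, sub_add_cancel]

lemma repMatrix_zero (a : F9 → ZMod 8 → ℤ) :
    repMatrix a 0 = (circulant (pushforward a)).map (Int.cast : ℤ → Eis) := by
  ext1 u v
  simp only [repMatrix, of_apply, zero_mul, psi_zero, one_mul, map_apply, circulant_apply,
    pushforward, Int.cast_sum]
  exact (mulE u).sum_comp fun z => (a z (u - v) : Eis)

lemma det_groupMatrix_eq (a : F9 → ZMod 8 → ℤ) :
    ((groupMatrix a).det : Eis) =
      ((circulant (pushforward a)).det : Eis) * (repMatrix a 1).det ^ 8 := by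
  rw [det_groupMatrix_eq_prod, prod_F9]
  simp only [det_repMatrix_e, Finset.prod_const, repMatrix_zero]
  congr 1
  exact ((Int.castRingHom Eis).map_det _).symm

lemma exists_det_repMatrix_eq_intCast (a : F9 → ZMod 8 → ℤ) :
    ∃ B : ℤ, (repMatrix a 1).det = B := by
  have h : star (repMatrix a 1).det = (repMatrix a 1).det := by
    rw [← det_repMatrix_e a 4]
    change starRingEnd Eis _ = _
    rw [det_repMatrix_e, RingHom.map_det, ← det_repMatrix_e a 4]
    congr 1
    ext1 u v
    simp only [repMatrix, RingHom.mapMatrix_apply, map_apply, of_apply, map_sum, map_mul, e_four,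
      one_mul, neg_one_mul, psi_neg_eq_star, map_intCast]
    rfl
  refine ⟨(repMatrix a 1).det.re, QuadraticAlgebra.ext rfl ?_⟩
  have h := congrArg QuadraticAlgebra.im h
  simp only [QuadraticAlgebra.im_star] at h
  simp only [QuadraticAlgebra.im_intCast]
  lia

/-! ### The congruence modulo 9 -/

/-- Reduction modulo 9, followed by adjoining an eighth root of unity. -/
noncomputable def redHom : Eis →+* W9 :=
  (QuadraticAlgebra.lift (a := (-1 : ℤ)) (b := -1)
    ⟨(⟨0, 1⟩ : W9), by decide +kernel⟩ : Eis →ₐ[ℤ] W9).toRingHom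

/-- The additive character `psi` with values in `W9`. -/
def psiW (x : F9) : W9 := (⟨0, 1⟩ : W9) ^ x.re.val

lemma redHom_psi (x : F9) : redHom (psi x) = psiW x := by
  rw [psi, psiW, map_pow]
  congr 1

/-- The uniformizer `1 - ω`. -/
def lam : W9 := ⟨1, -1⟩

lemma lam_pow_four : lam ^ 4 = 0 := by decide +kernel

/-- The base-3 digit sum of the representative in `{0, …, 7}`. -/
def digitSum (k : ZMod 8) : ℕ := k.val % 3 + k.val / 3

/-- Gauss sums over `F9`. -/
def gauss (x : F9) (k : ZMod 8) : W9 := ∑ u, T (u * k) * psiW (e (-u) * x)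

lemma gauss_zero_right : ∀ x, gauss x 0 = 8 := by decide +kernel

lemma gauss_zero_left : ∀ k, k ≠ 0 → gauss 0 k = 0 := by decide +kernel

lemma gauss_e : ∀ n k, gauss (e n) k = gauss 1 k * T (n * k) := by decide +kernel

lemma gauss_one : ∀ k, gauss 1 k = lam ^ digitSum k *
    (![⟨⟨8, 0⟩, 0⟩, ⟨0, ⟨0, 4⟩⟩, ⟨⟨2, 2⟩, ⟨2, 2⟩⟩, ⟨0, ⟨7, 5⟩⟩, ⟨⟨2, 0⟩, ⟨2, 0⟩⟩, ⟨0, ⟨0, 1⟩⟩,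
      ⟨⟨1, 1⟩, ⟨1, 1⟩⟩, ⟨0, ⟨1, 2⟩⟩] : Fin 8 → W9) k := by decide +kernel

/-- The divisibility of Gauss sums given by Stickelberger's theorem. -/
lemma lam_pow_dvd_gauss (x : F9) (k : ZMod 8) : lam ^ digitSum k ∣ gauss x k := by
  by_cases hx : x = 0
  · subst hx
    by_cases hk : k = 0
    · subst hk
      simp [digitSum]
    · simp [gauss_zero_left k hk]
  · obtain ⟨n, rfl⟩ := exists_e x hx
    rw [gauss_e]
    exact Dvd.dvd.mul_right ⟨_, gauss_one k⟩ _

lemma four_le_sum_digitSum (σ : Equiv.Perm (ZMod 8)) (hσ : σ ≠ 1) :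
    4 ≤ ∑ i, digitSum (i - σ i) := by
  have h0 : ((∑ i, (i - σ i).val : ℕ) : ZMod 8) = 0 := by
    simp [Finset.sum_sub_distrib, Equiv.sum_comp σ fun i => i]
  rw [ZMod.natCast_eq_zero_iff] at h0
  have h1 : ∑ i, (i - σ i).val = ∑ i, (i - σ i).val % 3 + 3 * ∑ i, (i - σ i).val / 3 := by
    rw [Finset.mul_sum, ← Finset.sum_add_distrib]
    exact Finset.sum_congr rfl fun i _ => (Nat.mod_add_div _ 3).symm
  have h2 : ∑ i, (i - σ i).val ≠ 0 := by
    intro h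
    rw [Finset.sum_eq_zero_iff] at h
    refine hσ (Equiv.ext fun i => ?_)
    have := h i (Finset.mem_univ i)
    rw [ZMod.val_eq_zero, sub_eq_zero] at this
    exact this.symm
  simp only [digitSum, Finset.sum_add_distrib]
  lia

/-- The matrix of the induced representation in the basis of characters of `ZMod 8`,
up to the scalar 8. -/
lemma conj_repMatrix_apply (a : F9 → ZMod 8 → ℤ) (i j : ZMod 8) :
    ((of fun i u => T (-(u * i))) * redHom.mapMatrix (repMatrix a 1) *
      of fun v j => T (v * j)) i j =
      ∑ t, T (-(t * j)) * ∑ z, (a z t : W9) * gauss z (j - i) := by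
  simp only [Matrix.mul_apply, of_apply, RingHom.mapMatrix_apply, map_apply, repMatrix, map_sum,
    map_mul, redHom_psi, map_intCast, one_mul, gauss, Finset.mul_sum, Finset.sum_mul]
  have h1 : ∀ u, ∑ v, ∑ z, T (-(u * i)) * (psiW z * (a (e u * z) (u - v) : W9)) * T (v * j) =
      ∑ t, ∑ z, T (-(t * j)) * ((a z t : W9) * (T (u * (j - i)) * psiW (e (-u) * z))) := by
    intro u
    rw [← (Equiv.subLeft u).sum_comp]
    refine Finset.sum_congr rfl fun t _ => ?_
    rw [← (mulE (-u)).sum_comp]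
    refine Finset.sum_congr rfl fun z _ => ?_
    simp only [Equiv.subLeft_apply, sub_sub_cancel, mulE, Equiv.coe_fn_mk]
    rw [← mul_assoc (e u), ← e_add, add_neg_cancel, e_zero, one_mul]
    have h2 : T (-(u * i)) * T ((u - t) * j) = T (-(t * j)) * T (u * (j - i)) := by
      rw [← T_add, ← T_add]
      congr 1
      ring
    linear_combination psiW (e (-u) * z) * (a z t : W9) * h2
  rw [Finset.sum_comm]
  simp only [h1]
  rw [Finset.sum_comm]
  exact Finset.sum_congr rfl fun t _ => Finset.sum_comm

lemma isUnit_eight : IsUnit (8 : W9) :=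
  IsUnit.of_mul_eq_one 8 (by decide +kernel)

lemma redHom_det_repMatrix (a : F9 → ZMod 8 → ℤ) :
    8 ^ 8 * redHom (repMatrix a 1).det =
      ∏ j, ∑ t, T (-(t * j)) * (8 * (pushforward a t : W9)) := by
  set X' : Matrix (ZMod 8) (ZMod 8) W9 := of fun i u => T (-(u * i)) with hX'
  set X : Matrix (ZMod 8) (ZMod 8) W9 := of fun v j => T (v * j) with hX
  have hXX : X' * X = (8 : W9) • 1 := by
    ext1 i j
    rw [Matrix.mul_apply, Matrix.smul_apply, one_apply]
    simp only [hX, hX', of_apply, ← T_add]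
    rw [Finset.sum_congr rfl fun u _ => congrArg T (show -(u * i) + u * j = u * (j - i) by ring),
      sum_T]
    simp only [sub_eq_zero, eq_comm (a := j)]
    split_ifs <;> simp
  have hdet : (X' * X).det = 8 ^ 8 := by
    rw [hXX, det_smul, det_one, mul_one, ZMod.card]
  have h := det_apply (X' * redHom.mapMatrix (repMatrix a 1) * X)
  rw [Finset.sum_eq_single 1] at h
  · rw [RingHom.map_det, ← hdet, ← det_mul_mul_eq, h, Equiv.Perm.sign_one, one_smul]
    refine Finset.prod_congr rfl fun j _ => ?_
    rw [Equiv.Perm.one_apply, conj_repMatrix_apply]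
    refine Finset.sum_congr rfl fun t _ => ?_
    simp only [sub_self, gauss_zero_right, pushforward, ← Finset.sum_mul, Int.cast_sum, mul_comm]
  · intro σ _ hσ
    have h0 : lam ^ 4 ∣ ∏ i, (X' * redHom.mapMatrix (repMatrix a 1) * X) (σ i) i := by
      refine (pow_dvd_pow lam (four_le_sum_digitSum σ hσ)).trans ?_
      rw [← Finset.prod_pow_eq_pow_sum]
      refine Finset.prod_dvd_prod_of_dvd _ _ fun i _ => ?_
      rw [conj_repMatrix_apply]
      exact Finset.dvd_sum fun t _ => Dvd.dvd.mul_left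
        (Finset.dvd_sum fun z _ => Dvd.dvd.mul_left (lam_pow_dvd_gauss z _) _) _
    rw [lam_pow_four, zero_dvd_iff] at h0
    rw [h0, smul_zero]
  · simp

lemma modEq_of_cast_W9_eq {m n : ℤ} (h : (m : W9) = n) : m ≡ n [ZMOD 9] := by
  have h := congrArg (fun x : W9 => x.re.re) h
  simp only [QuadraticAlgebra.re_intCast] at h
  exact (ZMod.intCast_eq_intCast_iff m n 9).mp h

/-- The representation of degree 8 and the regular representation of `ZMod 8` have congruent
determinants. -/
lemma modEq_circulant (a : F9 → ZMod 8 → ℤ) {B : ℤ} (hB : (repMatrix a 1).det = B) :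
    B ≡ (circulant (pushforward a)).det [ZMOD 9] := by
  let a₀ : F9 → ZMod 8 → ℤ := fun z t => if z = 0 then pushforward a t else 0
  have hpush : pushforward a₀ = pushforward a := by
    ext t
    simp [a₀, pushforward]
  have hcirc : repMatrix a₀ 1 = (circulant (pushforward a)).map (Int.cast : ℤ → Eis) := by
    ext1 u v
    simp only [repMatrix, of_apply, map_apply, circulant_apply, a₀]
    rw [Finset.sum_eq_single 0 ?_ (by simp)]
    · simp [psi_zero]
    · intro z _ hz
      simp [hz, e_ne_zero]
  have h1 := redHom_det_repMatrix a
  have h2 := redHom_det_repMatrix a₀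
  have h4 : ((circulant (pushforward a)).det : Eis) = _ :=
    (Int.castRingHom Eis).map_det (circulant (pushforward a))
  rw [hpush, ← h1, hcirc, hB] at h2
  have h3 := (isUnit_eight.pow 8).mul_left_cancel h2
  rw [show ((circulant (pushforward a)).map Int.cast).det = _ from h4.symm, map_intCast,
    map_intCast] at h3
  exact modEq_of_cast_W9_eq h3.symm

/-! ### Circulant determinants of size 8 -/

lemma isRegular_intCast_Z8 {n : ℤ} (hn : n ≠ 0) : IsRegular (n : Z8) :=
  isRegular_intCast_quadraticAlgebra
    (isRegular_intCast_quadraticAlgebra (IsRegular.of_ne_zero hn))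

lemma det_circulant_eq_prod (b : ZMod 8 → ℤ) :
    ((circulant b).det : Z8) = ∏ k, ∑ t, (b t : Z8) * chi (-(t * k)) := by
  have h := det_eq_of_mul_eq_mul (A := (circulant b).map (Int.cast : ℤ → Z8))
    (B := diagonal fun k => ∑ t, (b t : Z8) * chi (-(t * k)))
    (P := of fun u k => chi (u * k)) (Q := of fun k u => chi (-(u * k)))
    (isRegular_intCast_Z8 (n := 8) (by norm_num)) ?_ ?_
  · rw [det_diagonal] at h
    rw [← h]
    exact (Int.castRingHom Z8).map_det _
  · ext1 i j
    rw [Matrix.mul_apply, Matrix.smul_apply, one_apply]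
    simp only [of_apply, ← chi_add]
    rw [Finset.sum_congr rfl fun u _ => congrArg chi
      (show -(u * i) + u * j = u * (j - i) by ring), sum_chi]
    simp only [sub_eq_zero, eq_comm (a := j)]
    split_ifs <;> simp
  · ext1 u k
    rw [mul_diagonal, Matrix.mul_apply, ← (Equiv.subLeft u).sum_comp]
    simp only [map_apply, circulant_apply, of_apply, Equiv.subLeft_apply, sub_sub_cancel,
      Finset.mul_sum]
    refine Finset.sum_congr rfl fun t _ => ?_
    rw [show (u - t) * k = u * k + -(t * k) by ring, chi_add]
    ring

lemma sum_ZMod_eight {R : Type*} [AddCommMonoid R] (f : ZMod 8 → R) :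
    ∑ t, f t = f 0 + f 1 + f 2 + f 3 + f 4 + f 5 + f 6 + f 7 := Fin.sum_univ_eight f

lemma prod_ZMod_eight {R : Type*} [CommMonoid R] (f : ZMod 8 → R) :
    ∏ t, f t = (f 0 * f 4) * (f 2 * f 6) * ((f 1 * f 5) * (f 3 * f 7)) := by
  rw [show ∏ t, f t = _ from Fin.prod_univ_eight (f : Fin 8 → R)]
  change f 0 * f 1 * f 2 * f 3 * f 4 * f 5 * f 6 * f 7 = _
  ac_rfl

lemma chi_eq : ∀ t, chi t = ([1, ⟨0, 1⟩, ⟨⟨0, 1⟩, 0⟩, ⟨0, ⟨0, 1⟩⟩, -1, ⟨0, -1⟩, ⟨⟨0, -1⟩, 0⟩,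
    ⟨0, ⟨0, -1⟩⟩] : List Z8).getD t.val 0 := by
  decide +kernel

lemma Z8_mul_int (x y : ℤ) :
    (⟨⟨x, 0⟩, ⟨0, 0⟩⟩ : Z8) * ⟨⟨y, 0⟩, ⟨0, 0⟩⟩ = ⟨⟨x * y, 0⟩, ⟨0, 0⟩⟩ := by
  ext <;> simp

lemma Z8_mul_gaussian (x y : ℤ) :
    (⟨⟨x, -y⟩, ⟨0, 0⟩⟩ : Z8) * ⟨⟨x, y⟩, ⟨0, 0⟩⟩ = ⟨⟨x ^ 2 + y ^ 2, 0⟩, ⟨0, 0⟩⟩ := by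
  ext <;> simp
  all_goals ring

lemma Z8_mul_conj (x y z w : ℤ) :
    (⟨⟨x, y⟩, ⟨-z, -w⟩⟩ : Z8) * ⟨⟨x, y⟩, ⟨z, w⟩⟩ =
      ⟨⟨x ^ 2 - y ^ 2 + 2 * z * w, 2 * x * y - z ^ 2 + w ^ 2⟩, ⟨0, 0⟩⟩ := by
  ext <;> simp <;> ring

lemma det_circulant_eight (b : ZMod 8 → ℤ) :
    (circulant b).det =
      ((b 0 + b 4 + (b 2 + b 6)) ^ 2 - (b 1 + b 5 + (b 3 + b 7)) ^ 2) *
      ((b 0 + b 4 - (b 2 + b 6)) ^ 2 + (b 1 + b 5 - (b 3 + b 7)) ^ 2) *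
      (((b 0 - b 4) ^ 2 - (b 2 - b 6) ^ 2 + 2 * (b 1 - b 5) * (b 3 - b 7)) ^ 2 +
        (2 * (b 0 - b 4) * (b 2 - b 6) - (b 1 - b 5) ^ 2 + (b 3 - b 7) ^ 2) ^ 2) := by
  have hc : ∀ n m : ℤ, (n : Z8) = m → n = m := fun n m h => Int.cast_injective h
  apply hc
  rw [det_circulant_eq_prod]
  rw [prod_ZMod_eight]
  have h0 : ∑ t, (b t : Z8) * chi (-(t * 0)) =
      ⟨⟨b 0 + b 4 + (b 2 + b 6) + (b 1 + b 5 + (b 3 + b 7)), 0⟩, ⟨0, 0⟩⟩ := by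
    rw [sum_ZMod_eight]
    simp only [chi_eq]
    change (b 0 : Z8) * 1 + (b 1 : Z8) * 1 + (b 2 : Z8) * 1 + (b 3 : Z8) * 1 +
      (b 4 : Z8) * 1 + (b 5 : Z8) * 1 + (b 6 : Z8) * 1 + (b 7 : Z8) * 1 = _
    ext <;> simp
    ring
  have h1 : ∑ t, (b t : Z8) * chi (-(t * 1)) =
      ⟨⟨b 0 - b 4, -(b 2 - b 6)⟩, ⟨-(b 3 - b 7), -(b 1 - b 5)⟩⟩ := by
    rw [sum_ZMod_eight]
    simp only [chi_eq]
    change (b 0 : Z8) * 1 + (b 1 : Z8) * ⟨0, ⟨0, -1⟩⟩ + (b 2 : Z8) * ⟨⟨0, -1⟩, 0⟩ + (b 3 : Z8) * ⟨0, -1⟩ +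
      (b 4 : Z8) * -1 + (b 5 : Z8) * ⟨0, ⟨0, 1⟩⟩ + (b 6 : Z8) * ⟨⟨0, 1⟩, 0⟩ + (b 7 : Z8) * ⟨0, 1⟩ = _
    ext <;> simp <;> ring
  have h2 : ∑ t, (b t : Z8) * chi (-(t * 2)) =
      ⟨⟨b 0 + b 4 - (b 2 + b 6), -(b 1 + b 5 - (b 3 + b 7))⟩, ⟨0, 0⟩⟩ := by
    rw [sum_ZMod_eight]
    simp only [chi_eq]
    change (b 0 : Z8) * 1 + (b 1 : Z8) * ⟨⟨0, -1⟩, 0⟩ + (b 2 : Z8) * -1 + (b 3 : Z8) * ⟨⟨0, 1⟩, 0⟩ +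
      (b 4 : Z8) * 1 + (b 5 : Z8) * ⟨⟨0, -1⟩, 0⟩ + (b 6 : Z8) * -1 + (b 7 : Z8) * ⟨⟨0, 1⟩, 0⟩ = _
    ext <;> simp <;> ring
  have h3 : ∑ t, (b t : Z8) * chi (-(t * 3)) =
      ⟨⟨b 0 - b 4, b 2 - b 6⟩, ⟨-(b 1 - b 5), -(b 3 - b 7)⟩⟩ := by
    rw [sum_ZMod_eight]
    simp only [chi_eq]
    change (b 0 : Z8) * 1 + (b 1 : Z8) * ⟨0, -1⟩ + (b 2 : Z8) * ⟨⟨0, 1⟩, 0⟩ + (b 3 : Z8) * ⟨0, ⟨0, -1⟩⟩ +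
      (b 4 : Z8) * -1 + (b 5 : Z8) * ⟨0, 1⟩ + (b 6 : Z8) * ⟨⟨0, -1⟩, 0⟩ + (b 7 : Z8) * ⟨0, ⟨0, 1⟩⟩ = _
    ext <;> simp <;> ring
  have h4 : ∑ t, (b t : Z8) * chi (-(t * 4)) =
      ⟨⟨b 0 + b 4 + (b 2 + b 6) - (b 1 + b 5 + (b 3 + b 7)), 0⟩, ⟨0, 0⟩⟩ := by
    rw [sum_ZMod_eight]
    simp only [chi_eq]
    change (b 0 : Z8) * 1 + (b 1 : Z8) * -1 + (b 2 : Z8) * 1 + (b 3 : Z8) * -1 +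
      (b 4 : Z8) * 1 + (b 5 : Z8) * -1 + (b 6 : Z8) * 1 + (b 7 : Z8) * -1 = _
    ext <;> simp
    ring
  have h5 : ∑ t, (b t : Z8) * chi (-(t * 5)) =
      ⟨⟨b 0 - b 4, -(b 2 - b 6)⟩, ⟨b 3 - b 7, b 1 - b 5⟩⟩ := by
    rw [sum_ZMod_eight]
    simp only [chi_eq]
    change (b 0 : Z8) * 1 + (b 1 : Z8) * ⟨0, ⟨0, 1⟩⟩ + (b 2 : Z8) * ⟨⟨0, -1⟩, 0⟩ + (b 3 : Z8) * ⟨0, 1⟩ +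
      (b 4 : Z8) * -1 + (b 5 : Z8) * ⟨0, ⟨0, -1⟩⟩ + (b 6 : Z8) * ⟨⟨0, 1⟩, 0⟩ + (b 7 : Z8) * ⟨0, -1⟩ = _
    ext <;> simp <;> ring
  have h6 : ∑ t, (b t : Z8) * chi (-(t * 6)) =
      ⟨⟨b 0 + b 4 - (b 2 + b 6), b 1 + b 5 - (b 3 + b 7)⟩, ⟨0, 0⟩⟩ := by
    rw [sum_ZMod_eight]
    simp only [chi_eq]
    change (b 0 : Z8) * 1 + (b 1 : Z8) * ⟨⟨0, 1⟩, 0⟩ + (b 2 : Z8) * -1 + (b 3 : Z8) * ⟨⟨0, -1⟩, 0⟩ +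
      (b 4 : Z8) * 1 + (b 5 : Z8) * ⟨⟨0, 1⟩, 0⟩ + (b 6 : Z8) * -1 + (b 7 : Z8) * ⟨⟨0, -1⟩, 0⟩ = _
    ext <;> simp <;> ring
  have h7 : ∑ t, (b t : Z8) * chi (-(t * 7)) =
      ⟨⟨b 0 - b 4, b 2 - b 6⟩, ⟨b 1 - b 5, b 3 - b 7⟩⟩ := by
    rw [sum_ZMod_eight]
    simp only [chi_eq]
    change (b 0 : Z8) * 1 + (b 1 : Z8) * ⟨0, 1⟩ + (b 2 : Z8) * ⟨⟨0, 1⟩, 0⟩ + (b 3 : Z8) * ⟨0, ⟨0, 1⟩⟩ +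
      (b 4 : Z8) * -1 + (b 5 : Z8) * ⟨0, -1⟩ + (b 6 : Z8) * ⟨⟨0, -1⟩, 0⟩ + (b 7 : Z8) * ⟨0, ⟨0, -1⟩⟩ = _
    ext <;> simp <;> ring
  rw [h0, h1, h2, h3, h4, h5, h6, h7, Z8_mul_int, Z8_mul_gaussian,
    Z8_mul_conj, Z8_mul_conj,
    show (b 0 - b 4) ^ 2 - (-(b 2 - b 6)) ^ 2 + 2 * (b 3 - b 7) * (b 1 - b 5) =
      (b 0 - b 4) ^ 2 - (b 2 - b 6) ^ 2 + 2 * (b 1 - b 5) * (b 3 - b 7) by ring,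
    show 2 * (b 0 - b 4) * -(b 2 - b 6) - (b 3 - b 7) ^ 2 + (b 1 - b 5) ^ 2 =
      -(2 * (b 0 - b 4) * (b 2 - b 6) - (b 1 - b 5) ^ 2 + (b 3 - b 7) ^ 2) by ring,
    Z8_mul_gaussian, Z8_mul_int, Z8_mul_int, ← sq_sub_sq]
  rfl

lemma odd_or_dvd_det_circulant (b : ZMod 8 → ℤ) :
    Odd (circulant b).det ∨ (2 : ℤ) ^ 5 ∣ (circulant b).det := by
  rw [det_circulant_eight]
  by_cases h : Even (b 0 + b 4 + (b 2 + b 6) + (b 1 + b 5 + (b 3 + b 7)))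
  · right
    have h1 : (2 : ℤ) ∣ ((b 0 - b 4) ^ 2 - (b 2 - b 6) ^ 2 + 2 * (b 1 - b 5) * (b 3 - b 7)) ^ 2 +
        (2 * (b 0 - b 4) * (b 2 - b 6) - (b 1 - b 5) ^ 2 + (b 3 - b 7) ^ 2) ^ 2 := by
      rw [← even_iff_two_dvd]
      simp only [parity_simps] at h ⊢
      simp
      tauto
    rw [show (2 : ℤ) ^ 5 = 2 ^ 4 * 2 by norm_num]
    refine mul_dvd_mul ?_ h1
    generalize hX : b 0 + b 4 = p at *
    generalize hX : b 2 + b 6 = q at *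
    generalize hX : b 1 + b 5 = r at *
    generalize hX : b 3 + b 7 = s at *
    rcases Int.even_or_odd (p + q) with ⟨x, hx⟩ | ⟨x, hx⟩
    · have hy : Even (r + s) := by
        rw [Int.even_add] at h
        exact h.mp ⟨x, hx⟩
      obtain ⟨y, hy⟩ := hy
      obtain rfl : p = x + x - q := by lia
      obtain rfl : r = y + y - s := by lia
      exact ⟨(x ^ 2 - y ^ 2) * ((x - q) ^ 2 + (y - s) ^ 2), by ring⟩
    · have hy : Odd (r + s) := by
        rw [Int.even_add, ← not_iff_not, Int.not_even_iff_odd, Int.not_even_iff_odd] at h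
        exact h.mp ⟨x, hx⟩
      obtain ⟨y, hy⟩ := hy
      obtain rfl : p = 2 * x + 1 - q := by lia
      obtain rfl : r = 2 * y + 1 - s := by lia
      obtain ⟨m, hm⟩ := Int.even_mul_succ_self x
      obtain ⟨n, hn⟩ := Int.even_mul_succ_self y
      refine ⟨(m - n) * (2 * (x - q) ^ 2 + 2 * (x - q) + 2 * (y - s) ^ 2 + 2 * (y - s) + 1), ?_⟩
      have : (2 * x + 1 - q + q) ^ 2 - (2 * y + 1 - s + s) ^ 2 = 8 * (m - n) := by
        linear_combination 4 * hm - 4 * hn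
      rw [this]
      ring
  · left
    rw [← Int.not_even_iff_odd]
    simp only [parity_simps] at h ⊢
    simp
    tauto

/-! ### Construction of group ring elements -/

lemma exists_det_eq (f c w : ZMod 8 → ℤ) {D : ℤ} (hD : D ≠ 0) (hdet : (circulant f).det = D)
    (hfc : circulant f *ᵥ c = Pi.single 0 D) (hw : ∑ j, w j * c j = 1) (K y : ℤ) :
    ∃ a : F9 → ZMod 8 → ℤ, (circulant (pushforward a)).det = D + 8 * K * ∑ j, c j ∧
      (repMatrix a 1).det = ((D - K * ∑ j, c j + 9 * y : ℤ) : Eis) := by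
  have hmul : circulant f * circulant c = D • 1 := by
    rw [Matrix.circulant_mul, hfc]
    ext u v
    simp [circulant_apply, Pi.single_apply, one_apply, sub_eq_zero]
  let k : F9 → ℤ := fun x =>
    (if x = 0 then K - y * ∑ j, w j else 0) + ∑ j, if x = e (-j) then y * w j else 0
  have hk : ∀ {R : Type} [CommRing R] (g : F9 → R), ∑ x, (k x : R) * g x =
      (K - y * ∑ j, w j : ℤ) * g 0 + ∑ j, (y * w j : ℤ) * g (e (-j)) := by
    intro R _ g
    simp only [k, Int.cast_add, Int.cast_sum, add_mul, Finset.sum_add_distrib, Finset.sum_mul]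
    rw [Finset.sum_comm]
    simp only [Int.cast_ite, Int.cast_zero, ite_mul, zero_mul, Finset.sum_ite_eq',
      Finset.mem_univ, if_true]
  have hk1 : ∑ x, k x = K := by
    have := hk (R := ℤ) fun _ => 1
    simp only [Int.cast_id, mul_one, ← Finset.mul_sum] at this
    rw [this]
    ring
  refine ⟨fun z t => (if z = 0 then f t else 0) + k (z + e t), ?_, ?_⟩
  · have hpush : circulant (pushforward fun z t => (if z = 0 then f t else 0) + k (z + e t)) =
        circulant f + vecMulVec (fun _ => K) (fun _ => 1) := by
      ext1 u v
      simp only [pushforward, circulant_apply, Finset.sum_add_distrib, Finset.sum_ite_eq',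
        Finset.mem_univ, if_true, Matrix.add_apply, vecMulVec_apply, mul_one, add_right_inj]
      exact (Equiv.sum_comp (Equiv.addRight (e (u - v))) k).trans hk1
    rw [hpush, det_add_vecMulVec_of_mul_eq (IsRegular.of_ne_zero hD) hdet hmul]
    congr 1
    simp only [dotProduct, mulVec, circulant_apply, one_mul]
    have : ∀ u : ZMod 8, ∑ v, c (u - v) * K = K * ∑ j, c j := by
      intro u
      rw [← Finset.sum_mul, mul_comm]
      exact congrArg (K * ·) (Equiv.sum_comp (Equiv.subLeft u) c)
    simp only [this, Finset.sum_const, Finset.card_univ, ZMod.card, nsmul_eq_mul]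
    push_cast
    ring
  · have hrep : repMatrix (fun z t => (if z = 0 then f t else 0) + k (z + e t)) 1 =
        (circulant f).map (Int.cast : ℤ → Eis) +
          vecMulVec (fun u => ∑ x, (k x : Eis) * psi (e (-u) * x)) (fun v => psi (-e (-v))) := by
      ext1 u v
      simp only [repMatrix, of_apply, Matrix.add_apply, map_apply, circulant_apply, vecMulVec_apply,
        Int.cast_add, mul_add, Finset.sum_add_distrib, one_mul]
      congr 1
      · rw [Finset.sum_eq_single 0 ?_ (by simp)]
        · simp [psi_zero]
        · intro z _ hz
          simp [hz, e_ne_zero]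
      · rw [Finset.sum_mul]
        refine Fintype.sum_equiv ((mulE u).trans (Equiv.addRight (e (u - v)))) _ _ fun z => ?_
        have hz : e (-u) * (e u * z + e (u - v)) = z + e (-v) := by
          rw [mul_add, ← mul_assoc, ← e_add, ← e_add, neg_add_cancel, e_zero, one_mul]
          congr 2
          abel
        have hp : psi z = psi (z + e (-v)) * psi (-e (-v)) := by
          rw [← psi_add, add_neg_cancel_right]
        simp only [Equiv.trans_apply, Equiv.coe_addRight, mulE, Equiv.coe_fn_mk, hz]
        rw [hp]
        ring
    have hdet' : ((circulant f).map (Int.cast : ℤ → Eis)).det = D := by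
      rw [← hdet]
      exact (RingHom.map_det (Int.castRingHom Eis) _).symm
    have hmul' : (circulant f).map (Int.cast : ℤ → Eis) * (circulant c).map (Int.cast : ℤ → Eis) =
        (D : Eis) • 1 := by
      have := congrArg (Int.castRingHom Eis).mapMatrix hmul
      rw [map_mul] at this
      refine this.trans ?_
      ext1 u v
      rw [RingHom.mapMatrix_apply, map_apply, Matrix.smul_apply, Matrix.smul_apply, one_apply, one_apply]
      split_ifs <;> simp
    rw [hrep, det_add_vecMulVec_of_mul_eq (isRegular_intCast_eis hD) hdet' hmul']
    have hB : (fun v => psi (-e (-v))) ⬝ᵥ (circulant c).map (Int.cast : ℤ → Eis) *ᵥ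
        (fun u => ∑ x, (k x : Eis) * psi (e (-u) * x)) =
        ∑ x, (k x : Eis) * ∑ j, (c j : Eis) * (if x = e (-j) then 8 else -1) := by
      simp only [← sub_eq_zero (b := e _), ← sum_psi_units, dotProduct, mulVec, map_apply,
        circulant_apply, Finset.mul_sum]
      conv_lhs => enter [2, v]; rw [Finset.sum_comm]
      rw [Finset.sum_comm]
      refine Finset.sum_congr rfl fun x _ => ?_
      rw [Finset.sum_comm]
      conv_rhs => rw [Finset.sum_comm]
      refine Finset.sum_congr rfl fun u _ => ?_
      refine Fintype.sum_equiv (Equiv.subRight u) _ _ fun v => ?_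
      have hp : psi (e (-u) * (x - e (-(v - u)))) = psi (e (-u) * x) * psi (-e (-v)) := by
        rw [← psi_add, mul_sub, ← e_add, sub_eq_add_neg]
        congr 4
        abel
      simp only [Equiv.subRight_apply, hp]
      ring
    have h0 : ∀ j, (0 : F9) ≠ e (-j) := fun j => (e_ne_zero _).symm
    have he : ∀ i j, e (-i) = e (-j) ↔ i = j := fun i j => by
      rw [e_injective.eq_iff, neg_inj]
    have hsum : ∀ i, ∑ j, (c j : Eis) * (if i = j then 8 else -1) = 9 * c i - ∑ j, (c j : Eis) := by
      intro i
      rw [eq_sub_iff_add_eq, ← Finset.sum_add_distrib, Finset.sum_eq_single i]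
      · rw [if_pos rfl]; ring
      · intro j _ hj
        rw [if_neg hj.symm]; ring
      · simp
    have hw' : ∑ j, (w j : Eis) * c j = 1 := by exact_mod_cast congrArg (Int.cast : ℤ → Eis) hw
    rw [hB, hk]
    simp only [h0, he, if_false, hsum]
    push_cast
    rw [← Finset.sum_mul]
    have hyw : ∀ S : Eis, ∑ j, (y * w j : Eis) * (9 * c j - S) =
        9 * y * ∑ j, (w j : Eis) * c j - y * (∑ j, (w j : Eis)) * S := by
      intro S
      rw [Finset.mul_sum, Finset.mul_sum, Finset.sum_mul, ← Finset.sum_sub_distrib]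
      exact Finset.sum_congr rfl fun j _ => by ring
    rw [hyw, hw']
    ring

lemma exists_dets_eq_of_data {A B : ℤ} (hAB : B ≡ A [ZMOD 9]) (f c w : Fin 8 → ℤ) (D S K : ℤ)
    (hA : A = D + 8 * K * S) (hD : D ≠ 0)
    (hdet : (circulant (n := ZMod 8) f).det = D)
    (hfc : circulant (n := ZMod 8) f *ᵥ c = Pi.single (M := fun _ => ℤ) (0 : ZMod 8) D)
    (hS : ∑ j, c j = S) (hw : ∑ j, w j * c j = 1) :
    ∃ a : F9 → ZMod 8 → ℤ, (circulant (pushforward a)).det = A ∧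
      (repMatrix a 1).det = (B : Eis) := by
  obtain ⟨y, hy⟩ := (Int.modEq_iff_dvd.mp hAB.symm)
  obtain ⟨a, ha, hb⟩ := exists_det_eq f c w hD hdet hfc hw K (y + K * S)
  have hS' : ∑ j : ZMod 8, c j = S := hS
  refine ⟨a, ?_, ?_⟩
  · rw [ha, hS', hA]
  · rw [hb, hS']
    congr 1
    linear_combination -hy - hA

/-- Every pair satisfying the necessary conditions is attained. -/
lemma exists_dets_eq {A B : ℤ} (hA : Odd A ∨ (2 : ℤ) ^ 5 ∣ A) (hAB : B ≡ A [ZMOD 9]) :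
    ∃ a : F9 → ZMod 8 → ℤ, (circulant (pushforward a)).det = A ∧
      (repMatrix a 1).det = (B : Eis) := by
  obtain hA | ⟨n, hn⟩ := hA
  · obtain ⟨m, hm⟩ := hA
    obtain h | h | h | h : A = 1 + 8 * (A / 8) ∨ A = 3 + 8 * (A / 8) ∨ A = 5 + 8 * (A / 8) ∨
        A = 7 + 8 * (A / 8) := by lia
    · exact exists_dets_eq_of_data hAB ![1, 0, 0, 0, 0, 0, 0, 0] ![1, 0, 0, 0, 0, 0, 0, 0]
        ![1, 0, 0, 0, 0, 0, 0, 0] 1 1 (A / 8) (by lia) (by decide)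
        ((det_circulant_eight _).trans rfl) (by decide +kernel) (by decide) (by decide)
    · exact exists_dets_eq_of_data hAB ![1, 1, 1, 0, 0, 0, 0, 0] ![2, -1, -1, 2, -1, -1, 2, -1]
        ![1, 1, 0, 0, 0, 0, 0, 0] 3 1 (A / 8) (by lia) (by decide)
        ((det_circulant_eight _).trans rfl) (by decide +kernel) (by decide) (by decide)
    · exact exists_dets_eq_of_data hAB ![1, 1, 1, 1, 1, 0, 0, 0] ![2, -3, 2, -3, 2, 2, -3, 2]
        ![2, 1, 0, 0, 0, 0, 0, 0] 5 1 (A / 8) (by lia) (by decide)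
        ((det_circulant_eight _).trans rfl) (by decide +kernel) (by decide) (by decide)
    · exact exists_dets_eq_of_data hAB ![1, 1, 1, 1, 1, 1, 1, 0] ![1, -6, 1, 1, 1, 1, 1, 1]
        ![1, 0, 0, 0, 0, 0, 0, 0] 7 1 (A / 8) (by lia) (by decide)
        ((det_circulant_eight _).trans rfl) (by decide +kernel) (by decide) (by decide)
  · obtain ⟨m, hm⟩ | ⟨m, hm⟩ := Int.even_or_odd n
    · exact exists_dets_eq_of_data hAB ![2, 0, 1, 1, 1, 1, 1, 1]
        ![29, 21, 13, 5, -3, -11, -19, -27] ![0, 0, 2, -5, 0, 0, 0, 0] 64 8 (m - 1) (by lia)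
        (by decide) ((det_circulant_eight _).trans rfl) (by decide +kernel) (by decide) (by decide)
    · exact exists_dets_eq_of_data hAB ![1, 0, 0, 1, 0, 1, 0, 1]
        ![-11, -15, -3, -7, 5, 1, 13, 9] ![0, 0, 0, 0, 0, 1, 0, 0] (-32) (-8) (-m - 1) (by lia)
        (by decide) ((det_circulant_eight _).trans rfl) (by decide +kernel) (by decide) (by decide)

/-! ### Coordinates on `GA(1,9)` -/

lemma card_F9 : Fintype.card F9 = 9 := by decide +kernel

/-- An isomorphism from the concrete model of the field with nine elements. -/
noncomputable def fieldEquiv : F9 ≃+* GaloisField 3 2 :=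
  letI : Fintype (GaloisField 3 2) := Fintype.ofFinite _
  FiniteField.ringEquivOfCardEq <| by
    rw [card_F9, ← Nat.card_eq_fintype_card, GaloisField.card 3 2 two_ne_zero]
    norm_num

lemma fieldEquiv_e_mul (u v : ZMod 8) :
    fieldEquiv (e u) * fieldEquiv (e v) = fieldEquiv (e (u + v)) := by
  rw [e_add, map_mul]

/-- The units of the field with nine elements as powers of a generator. -/
noncomputable def unitOfExp (u : ZMod 8) : (GaloisField 3 2)ˣ where
  val := fieldEquiv (e u)
  inv := fieldEquiv (e (-u))
  val_inv := by rw [fieldEquiv_e_mul, add_neg_cancel, e_zero, map_one]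
  inv_val := by rw [fieldEquiv_e_mul, neg_add_cancel, e_zero, map_one]

/-- Coordinates on `GA(1,9)`: the pair `(u, x)` is `z ↦ γ ^ u * (z + x)`. -/
noncomputable def coordEquiv : ZMod 8 × F9 ≃ GA1 3 2 :=
  Equiv.ofBijective
    (fun p => ⟨Multiplicative.ofAdd (fieldEquiv (e p.1 * p.2)), unitOfExp p.1⟩) <| by
    constructor
    · rintro ⟨u, x⟩ ⟨v, y⟩ h
      rw [SemidirectProduct.ext_iff] at h
      obtain rfl : u = v := e_injective (fieldEquiv.injective (congrArg Units.val h.2))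
      have hxy : e u * x = e u * y := fieldEquiv.injective h.1
      rw [(mulE u).injective hxy]
    · rintro ⟨x, u⟩
      obtain ⟨t, ht⟩ := exists_e (fieldEquiv.symm u) (by simp)
      obtain ⟨y, hy⟩ := (mulE t).surjective (fieldEquiv.symm x.toAdd)
      change e t * y = _ at hy
      refine ⟨(t, y), SemidirectProduct.ext ?_ (Units.ext ?_)⟩
      · simp [hy]
      · simp [unitOfExp, ht]

lemma coordEquiv_mul_inv (p q : ZMod 8 × F9) :
    coordEquiv p * (coordEquiv q)⁻¹ = coordEquiv (p.1 - q.1, e q.1 * (p.2 - q.2)) := by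
  rw [mul_inv_eq_iff_eq_mul]
  refine SemidirectProduct.ext ?_ (Units.ext ?_)
  · change fieldEquiv (e p.1 * p.2) = fieldEquiv (e (p.1 - q.1) * (e q.1 * (p.2 - q.2))) +
      fieldEquiv (e (p.1 - q.1)) * fieldEquiv (e q.1 * q.2)
    rw [← map_mul, ← map_add, ← mul_add, ← mul_add, sub_add_cancel, ← mul_assoc, ← e_add,
      sub_add_cancel]
  · change fieldEquiv (e p.1) = fieldEquiv (e (p.1 - q.1)) * fieldEquiv (e q.1)
    rw [fieldEquiv_e_mul, sub_add_cancel]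

lemma groupDet_eq_det_groupMatrix (b : GA1 3 2 → ℤ) :
    groupDet (GA1 3 2) b =
      (groupMatrix fun x t => b (coordEquiv (t, e (-t) * x))).det := by
  classical
  let : Fintype (GA1 3 2) := Fintype.ofFinite _
  have : groupMatrix (fun x t => b (coordEquiv (t, e (-t) * x))) =
      (of fun g h : GA1 3 2 => b (g * h⁻¹)).submatrix coordEquiv coordEquiv := by
    ext1 p q
    simp only [groupMatrix, of_apply, submatrix_apply, coordEquiv_mul_inv]
    rw [← mul_assoc, ← e_add]
    congr 5
    abel
  rw [this, det_submatrix_equiv_self, groupDet]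
  congr!

lemma isIntGroupDet_iff {D : ℤ} :
    IsIntGroupDet (GA1 3 2) D ↔ ∃ a : F9 → ZMod 8 → ℤ, (groupMatrix a).det = D := by
  constructor
  · rintro ⟨b, rfl⟩
    exact ⟨_, (groupDet_eq_det_groupMatrix b).symm⟩
  · rintro ⟨a, rfl⟩
    refine ⟨fun g => a (e (coordEquiv.symm g).1 * (coordEquiv.symm g).2) (coordEquiv.symm g).1, ?_⟩
    rw [groupDet_eq_det_groupMatrix]
    congr 2
    funext x t
    rw [Equiv.symm_apply_apply, ← mul_assoc, ← e_add, add_neg_cancel, e_zero, one_mul]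

end GroupDetGA9

/-- The integer group determinants of `GA(1,9)` are exactly the `A * B^8` with
`A` odd or `2^5 ∣ A`, and `B ≡ A (mod 9)`. -/
theorem stmt4 (D : ℤ) :
    IsIntGroupDet (GA1 3 2) D ↔
      ∃ A B : ℤ, (Odd A ∨ (2 : ℤ) ^ 5 ∣ A) ∧ B ≡ A [ZMOD 9] ∧ D = A * B ^ 8 := by
  rw [GroupDetGA9.isIntGroupDet_iff]
  constructor
  · rintro ⟨a, rfl⟩
    obtain ⟨B, hB⟩ := GroupDetGA9.exists_det_repMatrix_eq_intCast a
    refine ⟨_, B, GroupDetGA9.odd_or_dvd_det_circulant _, GroupDetGA9.modEq_circulant a hB, ?_⟩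
    have h := GroupDetGA9.det_groupMatrix_eq a
    rw [hB] at h
    exact_mod_cast h
  · rintro ⟨A, B, hA, hAB, rfl⟩
    obtain ⟨a, ha, hb⟩ := GroupDetGA9.exists_dets_eq hA hAB
    refine ⟨a, ?_⟩
    have h := GroupDetGA9.det_groupMatrix_eq a
    rw [ha, hb] at h
    exact_mod_cast h
end
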